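/- The series ∑_{k=1}^∞ H_k·h_k²/k³ converges and equals (315/64)·ζ(6) - (49/32)·ζ(3)² - (1/2)·ζ(2)·S₃ + (1/8)·S₅, where S₃ = ∑_{k=1}^∞ h_k/k³ and S₅ = ∑_{k=1}^∞ h_k/k⁵. -/

import Mathlib

open Finset Real

noncomputable def H (k : ℕ) : ℝ := ∑ j ∈ Finset.range k, (1 : ℝ) / ((j : ℝ) + 1)
noncomputable def H2 (k : ℕ) : ℝ := ∑ j ∈ Finset.range k, (1 : ℝ) / ((j : ℝ) + 1) ^ 2
noncomputable def H3 (k : ℕ) : ℝ := ∑ j ∈ Finset.range k, (1 : ℝ) / ((j : ℝ) + 1) ^ 3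
noncomputable def h (k : ℕ) : ℝ := ∑ j ∈ Finset.range k, (1 : ℝ) / (2 * (j : ℝ) + 1)
noncomputable def h2 (k : ℕ) : ℝ := ∑ j ∈ Finset.range k, (1 : ℝ) / (2 * (j : ℝ) + 1) ^ 2
noncomputable def h3 (k : ℕ) : ℝ := ∑ j ∈ Finset.range k, (1 : ℝ) / (2 * (j : ℝ) + 1) ^ 3
noncomputable def zeta (s : ℕ) : ℝ := ∑' n : ℕ, (1 : ℝ) / ((n : ℝ) + 1) ^ s

theorem h_zero : h 0 = 0 := Finset.sum_range_zero _

theorem h_succ (n : ℕ) : h (n + 1) = h n + 1 / (2 * (n : ℝ) + 1) := Finset.sum_range_succ _ _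

theorem h_nonneg (n : ℕ) : 0 ≤ h n := Finset.sum_nonneg fun _ _ => by positivity

theorem one_le_h_succ (n : ℕ) : 1 ≤ h (n + 1) := by
  induction n with
  | zero => simp [h]
  | succ n ih =>
    rw [h_succ]
    have : 0 ≤ 1 / (2 * ((n + 1 : ℕ) : ℝ) + 1) := by positivity
    linarith

theorem h_le_one_add_log (n : ℕ) : h n ≤ 1 + log n := by
  refine le_trans ?_ (harmonic_le_one_add_log n)
  rw [harmonic, Rat.cast_sum]
  refine Finset.sum_le_sum fun j _ => ?_
  push_cast
  rw [← one_div]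
  gcongr
  linarith [(Nat.cast_nonneg j : (0 : ℝ) ≤ j)]

theorem tendsto_h_sq_div : Filter.Tendsto (fun n : ℕ => h n ^ 2 / ((n : ℝ) + 1))
    Filter.atTop (nhds 0) := by
  have key : Filter.Tendsto (fun x : ℝ => (1 + log x) ^ 2 / x) Filter.atTop (nhds 0) := by
    have h0 : Filter.Tendsto (fun x : ℝ => x⁻¹) Filter.atTop (nhds 0) := tendsto_inv_atTop_zero
    have h1 := (isLittleO_pow_log_id_atTop (n := 1)).tendsto_div_nhds_zero
    have h2 := (isLittleO_pow_log_id_atTop (n := 2)).tendsto_div_nhds_zero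
    have := (h0.add (h1.const_mul 2)).add h2
    simp only [mul_zero, add_zero, id] at this
    refine this.congr fun x => ?_
    ring
  refine squeeze_zero' (.of_forall fun n => by positivity) ?_
    (key.comp tendsto_natCast_atTop_atTop)
  filter_upwards [Filter.eventually_gt_atTop 0] with n hn
  have hn' : (0 : ℝ) < n := by exact_mod_cast hn
  have := h_nonneg n
  have := h_le_one_add_log n
  simp only [Function.comp]
  gcongr
  linarith

theorem tendsto_h_div : Filter.Tendsto (fun n : ℕ => h n / ((n : ℝ) + 1))
    Filter.atTop (nhds 0) := by
  refine squeeze_zero' (.of_forall fun n => div_nonneg (h_nonneg n) (by positivity)) ?_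
    tendsto_h_sq_div
  filter_upwards [Filter.eventually_gt_atTop 0] with n hn
  obtain ⟨m, rfl⟩ := Nat.exists_eq_succ_of_ne_zero hn.ne'
  have := one_le_h_succ m
  gcongr
  nlinarith

/-- Multiplying a sequence that is negligible against `n` by reciprocals of linear functions. -/
theorem tendsto_div_add_zero {a : ℕ → ℝ} (ha : ∀ n, 0 ≤ a n)
    (hlim : Filter.Tendsto (fun n : ℕ => a n / ((n : ℝ) + 1)) Filter.atTop (nhds 0))
    {c : ℝ} (hc : 1 ≤ c) :
    Filter.Tendsto (fun n : ℕ => a n / ((n : ℝ) + c)) Filter.atTop (nhds 0) :=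
  squeeze_zero (fun n => div_nonneg (ha n) (by positivity))
    (fun n => by have := ha n; gcongr) hlim

theorem hasSum_of_telescoping {f v : ℕ → ℝ} (hf : Summable f)
    (hfv : ∀ n, f n = v n - v (n + 1)) (hv : Filter.Tendsto v Filter.atTop (nhds 0)) :
    HasSum f (v 0) := by
  have h1 := hf.hasSum.tendsto_sum_nat
  have h2 : Filter.Tendsto (fun n => ∑ i ∈ Finset.range n, f i) Filter.atTop (nhds (v 0)) := by
    have : ∀ n, ∑ i ∈ Finset.range n, f i = v 0 - v n := fun n => by
      simp_rw [hfv]; exact Finset.sum_range_sub' v n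
    simpa [this] using hv.const_sub (v 0)
  rw [← tendsto_nhds_unique h1 h2]
  exact hf.hasSum

theorem hasSum_of_nonneg_telescoping {f v : ℕ → ℝ} (hf : ∀ n, 0 ≤ f n)
    (hfv : ∀ n, f n = v n - v (n + 1)) (hv : Filter.Tendsto v Filter.atTop (nhds 0)) :
    HasSum f (v 0) := by
  rw [hasSum_iff_tendsto_nat_of_nonneg hf]
  have : ∀ n, ∑ i ∈ Finset.range n, f i = v 0 - v n := fun n => by
    simp_rw [hfv]; exact Finset.sum_range_sub' v n
  simpa [this] using hv.const_sub (v 0)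

theorem hasSum_swap_of_nonneg {f : ℕ → ℕ → ℝ} (hf : ∀ i j, 0 ≤ f i j) {a b : ℕ → ℝ} {A : ℝ}
    (hrow : ∀ i, HasSum (f i) (a i)) (hcol : ∀ j, HasSum (fun i => f i j) (b j))
    (hA : HasSum a A) : HasSum b A := by
  have hs : Summable (fun p : ℕ × ℕ => f p.1 p.2) :=
    (summable_prod_of_nonneg fun p => hf p.1 p.2).2
      ⟨fun i => (hrow i).summable, by simpa [(hrow _).tsum_eq] using hA.summable⟩
  have h1 := hs.hasSum.prod_fiberwise hrow
  have h2 : HasSum (fun p : ℕ × ℕ => f p.2 p.1) A :=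
    (Equiv.prodComm ℕ ℕ).hasSum_iff (f := fun p : ℕ × ℕ => f p.1 p.2) |>.2
      (h1.unique hA ▸ hs.hasSum)
  exact h2.prod_fiberwise hcol

/-- The partial sums of `∑ h n / n`. -/
noncomputable def hDivSum (n : ℕ) : ℝ := ∑ j ∈ Finset.range n, h (j + 1) / ((j : ℝ) + 1)

/-- The partial sums of `∑ hDivSum n / (2 n + 1)`. -/
noncomputable def hDivOddSum (n : ℕ) : ℝ :=
  ∑ j ∈ Finset.range n, hDivSum j / (2 * (j : ℝ) + 1)

/-- The regularised shifted sum `∑ a n (1 / n - 1 / (n + i))` over `n ≥ 1`. -/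
noncomputable def shiftSum (a : ℕ → ℝ) (i : ℕ) : ℝ :=
  ∑' n : ℕ, a (n + 1) * (1 / ((n : ℝ) + 1) - 1 / ((n : ℝ) + 1 + i))

theorem shiftSum_zero (a : ℕ → ℝ) : shiftSum a 0 = 0 := by simp [shiftSum]

theorem hasSum_shiftSum {a : ℕ → ℝ} (ha : ∀ n, 0 ≤ a n)
    (hs : Summable fun n : ℕ => a (n + 1) / ((n : ℝ) + 1) ^ 2) (i : ℕ) :
    HasSum (fun n : ℕ => a (n + 1) * (1 / ((n : ℝ) + 1) - 1 / ((n : ℝ) + 1 + i)))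
      (shiftSum a i) := by
  refine Summable.hasSum (Summable.of_nonneg_of_le (fun n => ?_) (fun n => ?_)
    (hs.mul_left (i : ℝ)))
  · refine mul_nonneg (ha _) (sub_nonneg.2 ?_)
    exact one_div_le_one_div_of_le (by positivity) (by simp)
  · have h1 : 1 / ((n : ℝ) + 1) - 1 / ((n : ℝ) + 1 + i) =
        i / (((n : ℝ) + 1) * ((n : ℝ) + 1 + i)) := by
      field_simp
      ring
    have h2 : (i : ℝ) / (((n : ℝ) + 1) * ((n : ℝ) + 1 + i)) ≤ i / ((n : ℝ) + 1) ^ 2 := by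
      rw [sq]
      exact div_le_div_of_nonneg_left (by positivity) (by positivity)
        (mul_le_mul_of_nonneg_left (by simp) (by positivity))
    calc _ ≤ a (n + 1) * (i / ((n : ℝ) + 1) ^ 2) := by
          rw [h1]; exact mul_le_mul_of_nonneg_left h2 (ha _)
      _ = _ := by ring

theorem hasSum_shiftSum_succ_sub {a : ℕ → ℝ} (ha : ∀ n, 0 ≤ a n)
    (hs : Summable fun n : ℕ => a (n + 1) / ((n : ℝ) + 1) ^ 2) (i : ℕ) :
    HasSum (fun n : ℕ => a (n + 1) * (1 / ((n : ℝ) + 1 + i) - 1 / ((n : ℝ) + 2 + i)))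
      (shiftSum a (i + 1) - shiftSum a i) := by
  convert! (hasSum_shiftSum ha hs (i + 1)).sub (hasSum_shiftSum ha hs i) using 2 with n
  push_cast
  rw [show (n : ℝ) + 1 + (i + 1) = n + 2 + i by ring]
  ring

theorem summable_h_div_sq (hs : Summable fun n : ℕ => h (n + 1) ^ 2 / ((n : ℝ) + 1) ^ 2) :
    Summable fun n : ℕ => h (n + 1) / ((n : ℝ) + 1) ^ 2 := by
  refine hs.of_nonneg_of_le (fun n => div_nonneg (h_nonneg _) (by positivity)) fun n => ?_
  have := one_le_h_succ n
  gcongr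
  nlinarith

theorem shiftSum_h_recurrence (hs : Summable fun n : ℕ => h (n + 1) / ((n : ℝ) + 1) ^ 2) (i : ℕ) :
    (2 * (i : ℝ) + 3) * (shiftSum h (i + 2) - shiftSum h (i + 1)) =
      (2 * (i : ℝ) + 1) * (shiftSum h (i + 1) - shiftSum h i) + 1 / ((i : ℝ) + 1) := by
  have hb := (hasSum_shiftSum_succ_sub h_nonneg hs (i + 1)).mul_left (2 * (i : ℝ) + 3)
  have ha := (hasSum_shiftSum_succ_sub h_nonneg hs i).mul_left (2 * (i : ℝ) + 1)
  have hlim : ∀ c : ℝ, 1 ≤ c → Filter.Tendsto (fun n : ℕ => h n / ((n : ℝ) + c))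
      Filter.atTop (nhds 0) := fun c hc => tendsto_div_add_zero h_nonneg tendsto_h_div hc
  have hone : Filter.Tendsto (fun n : ℕ => 1 / ((n : ℝ) + (i + 1))) Filter.atTop (nhds 0) :=
    tendsto_div_add_zero (fun _ => zero_le_one) tendsto_one_div_add_atTop_nhds_zero_nat
      (by linarith [(Nat.cast_nonneg i : (0 : ℝ) ≤ i)])
  have hi : (0 : ℝ) ≤ i := Nat.cast_nonneg i
  have ht := hasSum_of_telescoping (hb.sub ha).summable
    (v := fun n : ℕ => (2 * (i : ℝ) + 3) * (h n / ((n : ℝ) + (i + 2))) -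
      (2 * (i : ℝ) + 1) * (h n / ((n : ℝ) + (i + 1))) + 1 / ((n : ℝ) + (i + 1)))
    (fun n => by
      rw [h_succ]
      push_cast
      field_simp
      ring)
    (by simpa using (((hlim _ (by linarith)).const_mul (2 * (i : ℝ) + 3)).sub
      ((hlim _ (by linarith)).const_mul (2 * (i : ℝ) + 1))).add hone)
  have := (hb.sub ha).unique ht
  simp [h_zero] at this
  rw [one_div]
  linarith

theorem h_mul_shiftSum_h_sub (hs : Summable fun n : ℕ => h (n + 1) / ((n : ℝ) + 1) ^ 2) (i : ℕ) :
    (2 * (i : ℝ) + 1) * (h i * (shiftSum h (i + 1) - shiftSum h i)) =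
      shiftSum h i + hDivSum i := by
  induction i with
  | zero => simp [h_zero, shiftSum_zero, hDivSum]
  | succ i ih =>
    have hr := shiftSum_h_recurrence hs i
    have hd : hDivSum (i + 1) = hDivSum i + h (i + 1) * (1 / ((i : ℝ) + 1)) := by
      rw [hDivSum, Finset.sum_range_succ, ← hDivSum]; ring
    have hh : (2 * (i : ℝ) + 1) * h (i + 1) = (2 * (i : ℝ) + 1) * h i + 1 := by
      rw [h_succ]; field_simp
    push_cast
    rw [hd]
    linear_combination h (i + 1) * hr + ih + (shiftSum h (i + 1) - shiftSum h i) * hh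

theorem shiftSum_h_sq_succ_sub (hs : Summable fun n : ℕ => h (n + 1) ^ 2 / ((n : ℝ) + 1) ^ 2)
    {κ : ℝ} (hκ : HasSum (fun n : ℕ => h (n + 1) / ((n : ℝ) + 1) *
      (1 / (2 * (n : ℝ) + 1) - 1 / (2 * (n : ℝ) + 3))) κ) (i : ℕ) :
    (2 * (i : ℝ) + 1) * (shiftSum (fun n => h n ^ 2) (i + 1) - shiftSum (fun n => h n ^ 2) i) =
      κ + shiftSum h (i + 1) + shiftSum h i := by
  have hs1 := summable_h_div_sq hs
  have hsq : ∀ n, 0 ≤ h n ^ 2 := fun n => sq_nonneg _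
  have hd := (hasSum_shiftSum_succ_sub (a := fun n => h n ^ 2) hsq hs i).mul_left (2 * (i : ℝ) + 1)
  have he := (hκ.add (hasSum_shiftSum h_nonneg hs1 (i + 1))).add (hasSum_shiftSum h_nonneg hs1 i)
  have hi : (0 : ℝ) ≤ i := Nat.cast_nonneg i
  have ht := hasSum_of_telescoping (hd.sub he).summable
    (v := fun n : ℕ => (2 * (i : ℝ) + 1) * (h n ^ 2 / ((n : ℝ) + (i + 1))) +
      (h n / ((n : ℝ) + 1 / 2) - h n / ((n : ℝ) + (i + 1))))
    (fun n => by
      rw [h_succ]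
      push_cast
      field_simp
      ring)
    (by
      have h1 := tendsto_div_add_zero hsq tendsto_h_sq_div (show 1 ≤ (i : ℝ) + 1 by linarith)
      have h2 := tendsto_div_add_zero h_nonneg tendsto_h_div (show 1 ≤ (i : ℝ) + 1 by linarith)
      have h3 : Filter.Tendsto (fun n : ℕ => h n / ((n : ℝ) + 1 / 2)) Filter.atTop (nhds 0) := by
        refine squeeze_zero (fun n => div_nonneg (h_nonneg n) (by positivity)) (fun n => ?_)
          (by simpa using tendsto_h_div.const_mul 2)
        have := h_nonneg n
        rw [← mul_div_assoc, div_le_div_iff₀ (by positivity) (by positivity)]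
        nlinarith [mul_nonneg this (Nat.cast_nonneg (α := ℝ) n)]
      simpa using (h1.const_mul (2 * (i : ℝ) + 1)).add (h3.sub h2))
  have := (hd.sub he).unique ht
  simp [h_zero] at this
  linarith

theorem shiftSum_h_sq_eq (hs : Summable fun n : ℕ => h (n + 1) ^ 2 / ((n : ℝ) + 1) ^ 2)
    {κ : ℝ} (hκ : HasSum (fun n : ℕ => h (n + 1) / ((n : ℝ) + 1) *
      (1 / (2 * (n : ℝ) + 1) - 1 / (2 * (n : ℝ) + 3))) κ) (i : ℕ) :
    shiftSum (fun n => h n ^ 2) i = κ * h i + h i * shiftSum h i - hDivOddSum i := by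
  induction i with
  | zero => simp [h_zero, shiftSum_zero, hDivOddSum]
  | succ i ih =>
    have h1 := shiftSum_h_sq_succ_sub hs hκ i
    have h2 := h_mul_shiftSum_h_sub (summable_h_div_sq hs) i
    have hi : (2 * (i : ℝ) + 1) ≠ 0 := by positivity
    rw [hDivOddSum, Finset.sum_range_succ, ← hDivOddSum, h_succ]
    refine mul_left_cancel₀ hi ?_
    field_simp
    linear_combination h1 + (2 * (i : ℝ) + 1) * ih - h2

theorem hasSum_antidiagonal_mul {f g : ℕ → ℝ} {F G : ℝ} (hf : HasSum f F) (hg : HasSum g G) :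
    HasSum (fun n => ∑ p ∈ Finset.HasAntidiagonal.antidiagonal n, f p.1 * g p.2) (F * G) := by
  have hf' : Summable fun n => ‖f n‖ := hf.summable.norm
  have hg' : Summable fun n => ‖g n‖ := hg.summable.norm
  rw [← hf.tsum_eq, ← hg.tsum_eq, tsum_mul_tsum_eq_tsum_sum_antidiagonal_of_summable_norm hf' hg']
  exact (summable_norm_sum_mul_antidiagonal_of_summable_norm hf' hg').of_norm.hasSum

theorem hasSum_coeff_mul {P Q : PowerSeries ℝ} {u F G : ℝ}
    (hP : HasSum (fun n => PowerSeries.coeff n P * u ^ n) F)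
    (hQ : HasSum (fun n => PowerSeries.coeff n Q * u ^ n) G) :
    HasSum (fun n => PowerSeries.coeff n (P * Q) * u ^ n) (F * G) := by
  convert! hasSum_antidiagonal_mul hP hQ using 2 with n
  rw [PowerSeries.coeff_mul, Finset.sum_mul]
  refine Finset.sum_congr rfl fun p hp => ?_
  rw [← Finset.HasAntidiagonal.mem_antidiagonal.1 hp, pow_add]
  ring

/-- The power series `∑ Xⁿ / (2 n + 1)`, so that `artanh x = x * artanhSeries (x²)`. -/
noncomputable def artanhSeries : PowerSeries ℝ := PowerSeries.mk fun n => 1 / (2 * (n : ℝ) + 1)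

theorem hasSum_artanhSeries_pow {x : ℝ} (hx : x ∈ Set.Ioo (0 : ℝ) 1) (p : ℕ) :
    HasSum (fun n => PowerSeries.coeff n (artanhSeries ^ p) * (x ^ 2) ^ n)
      ((artanh x / x) ^ p) := by
  have hx0 := hx.1
  have h1 : HasSum (fun n => PowerSeries.coeff n artanhSeries * (x ^ 2) ^ n) (artanh x / x) := by
    have hs := hasSum_log_sub_log_of_abs_lt_one (abs_lt.2 ⟨by linarith, hx.2⟩)
    convert! hs.mul_left (1 / (2 * x)) using 1
    · ext n
      rw [artanhSeries, PowerSeries.coeff_mk, ← pow_mul]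
      field_simp
      ring
    · rw [artanh_eq_half_log ⟨by linarith, hx.2.le⟩, log_div (by linarith) (by linarith [hx.2])]
      field_simp
  induction p with
  | zero =>
    convert! hasSum_ite_eq (0 : ℕ) (1 : ℝ) using 2 with n
    rw [pow_zero, PowerSeries.coeff_one]
    split_ifs with hn <;> simp [hn]
  | succ p ih =>
    rw [pow_succ, pow_succ]
    exact hasSum_coeff_mul ih h1

theorem coeff_artanhSeries_pow_succ (p n : ℕ) :
    (2 * (n : ℝ) + (p + 1)) * PowerSeries.coeff n (artanhSeries ^ (p + 1)) =
      (p + 1) * ∑ m ∈ Finset.range (n + 1), PowerSeries.coeff m (artanhSeries ^ p) := by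
  have hX : ∀ (P : PowerSeries ℝ) (n : ℕ),
      PowerSeries.coeff n (PowerSeries.X * PowerSeries.derivative ℝ P) =
        n * PowerSeries.coeff n P := by
    intro P n
    cases n with
    | zero => simp
    | succ n =>
      rw [PowerSeries.coeff_succ_X_mul, PowerSeries.coeff_derivative]
      push_cast
      ring
  have hode : 2 * (PowerSeries.X * PowerSeries.derivative ℝ artanhSeries) + artanhSeries =
      PowerSeries.mk 1 := by
    ext n
    rw [map_add, two_mul, map_add, hX, artanhSeries, PowerSeries.coeff_mk, PowerSeries.coeff_mk,
      Pi.one_apply]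
    field_simp
    ring
  have hder : 2 * (PowerSeries.X * PowerSeries.derivative ℝ (artanhSeries ^ (p + 1))) +
      (p + 1) • artanhSeries ^ (p + 1) =
      (p + 1) • (artanhSeries ^ p * PowerSeries.mk 1) := by
    rw [← hode, Derivation.leibniz_pow]
    simp only [nsmul_eq_mul, smul_eq_mul, Nat.add_sub_cancel]
    ring
  have hc := congrArg (PowerSeries.coeff n) hder
  rw [map_add, two_mul, map_add, hX, map_nsmul, map_nsmul,
    PowerSeries.coeff_mul, Finset.Nat.sum_antidiagonal_eq_sum_range_succ_mk] at hc
  simp only [PowerSeries.coeff_mk, Pi.one_apply, mul_one, nsmul_eq_mul] at hc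
  push_cast at hc
  rw [← hc]
  ring

theorem coeff_artanhSeries_sq (n : ℕ) :
    PowerSeries.coeff n (artanhSeries ^ 2) = h (n + 1) / ((n : ℝ) + 1) := by
  have hc := coeff_artanhSeries_pow_succ 1 n
  simp only [pow_one, artanhSeries, PowerSeries.coeff_mk] at hc
  rw [← h, ← artanhSeries] at hc
  field_simp
  push_cast at hc
  linarith

theorem coeff_artanhSeries_pow_four (n : ℕ) :
    PowerSeries.coeff n (artanhSeries ^ 4) = 6 * hDivOddSum (n + 2) / ((n : ℝ) + 2) := by
  have h3 : ∀ m : ℕ, PowerSeries.coeff m (artanhSeries ^ 3) =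
      3 * (hDivSum (m + 1) / (2 * ((m + 1 : ℕ) : ℝ) + 1)) := by
    intro m
    have hc := coeff_artanhSeries_pow_succ 2 m
    simp only [coeff_artanhSeries_sq] at hc
    rw [← hDivSum] at hc
    push_cast at hc ⊢
    field_simp
    linarith
  have hc := coeff_artanhSeries_pow_succ 3 n
  simp only [h3, ← Finset.mul_sum] at hc
  have hG : hDivOddSum (n + 2) =
      ∑ m ∈ Finset.range (n + 1), hDivSum (m + 1) / (2 * ((m + 1 : ℕ) : ℝ) + 1) := by
    rw [hDivOddSum, Finset.sum_range_succ']
    simp [hDivSum]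
  rw [← hG] at hc
  push_cast at hc
  field_simp
  linarith

theorem hasSum_of_tsum_ofReal_eq {a : ℕ → ℝ} {A : ℝ} (ha : ∀ n, 0 ≤ a n) (hA : 0 ≤ A)
    (hs : ∑' n, ENNReal.ofReal (a n) = ENNReal.ofReal A) : HasSum a A := by
  have hsum : Summable a := by
    have := ENNReal.summable_toReal (f := fun n => ENNReal.ofReal (a n))
      (hs ▸ ENNReal.ofReal_ne_top)
    simpa [ENNReal.toReal_ofReal (ha _)] using this
  rw [← ENNReal.ofReal_tsum_of_nonneg ha hsum,
    ENNReal.ofReal_eq_ofReal_iff (tsum_nonneg ha) hA] at hs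
  exact hs ▸ hsum.hasSum

theorem tsum_ofReal_eq_of_hasSum {a : ℕ → ℝ} {A : ℝ} (ha : ∀ n, 0 ≤ a n) (hs : HasSum a A) :
    ∑' n, ENNReal.ofReal (a n) = ENNReal.ofReal A := by
  rw [← ENNReal.ofReal_tsum_of_nonneg ha hs.summable, hs.tsum_eq]

theorem lintegral_Ioo_eq_tsum {f : ℕ → ℝ → ℝ} {F : ℝ → ℝ} {a : ℕ → ℝ}
    (hm : ∀ n, Measurable (f n)) (hf0 : ∀ n, ∀ x ∈ Set.Ioo (0 : ℝ) 1, 0 ≤ f n x)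
    (hF : ∀ x ∈ Set.Ioo (0 : ℝ) 1, HasSum (fun n => f n x) (F x))
    (ha : ∀ n, ∫⁻ x in Set.Ioo (0 : ℝ) 1, ENNReal.ofReal (f n x) = ENNReal.ofReal (a n)) :
    ∫⁻ x in Set.Ioo (0 : ℝ) 1, ENNReal.ofReal (F x) = ∑' n, ENNReal.ofReal (a n) := by
  simp_rw [← ha]
  rw [← MeasureTheory.lintegral_tsum fun n => (hm n).ennreal_ofReal.aemeasurable]
  refine MeasureTheory.setLIntegral_congr_fun measurableSet_Ioo fun x hx => ?_
  exact (tsum_ofReal_eq_of_hasSum (fun n => hf0 n x hx) (hF x hx)).symm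

theorem lintegral_Ioo_const_mul {c : ℝ} (hc : 0 ≤ c) {f : ℝ → ℝ} {I : ℝ} (hf : Measurable f)
    (hI : ∫⁻ x in Set.Ioo (0 : ℝ) 1, ENNReal.ofReal (f x) = ENNReal.ofReal I) :
    ∫⁻ x in Set.Ioo (0 : ℝ) 1, ENNReal.ofReal (c * f x) = ENNReal.ofReal (c * I) := by
  simp_rw [ENNReal.ofReal_mul hc]
  rw [MeasureTheory.lintegral_const_mul _ hf.ennreal_ofReal, hI]

theorem lintegral_Ioo_pow_mul_neg_log_pow (n b : ℕ) :
    ∫⁻ x in Set.Ioo (0 : ℝ) 1, ENNReal.ofReal (x ^ n * (-log x) ^ b) =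
      ENNReal.ofReal (b.factorial / ((n : ℝ) + 1) ^ (b + 1)) := by
  have himage : (fun u : ℝ => exp (-u)) '' Set.Ioi 0 = Set.Ioo 0 1 := by
    ext x
    constructor
    · rintro ⟨u, hu, rfl⟩
      exact ⟨exp_pos _, by simpa using hu⟩
    · rintro ⟨h0, h1⟩
      exact ⟨-log x, neg_pos.2 (log_neg h0 h1), by simp [exp_log h0]⟩
  rw [← himage, MeasureTheory.lintegral_image_eq_lintegral_abs_deriv_mul measurableSet_Ioi
    (f' := fun u : ℝ => -exp (-u))
    (fun u _ => by simpa using ((hasDerivAt_neg u).exp).hasDerivWithinAt)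
    (fun u _ v _ huv => by simpa using huv)]
  have hΓ := integral_rpow_mul_exp_neg_mul_Ioi (a := b + 1) (r := n + 1) (by positivity)
    (by positivity)
  rw [Gamma_nat_eq_factorial, one_div, inv_rpow (by positivity)] at hΓ
  have hval : (((n : ℝ) + 1) ^ ((b : ℝ) + 1))⁻¹ * (b.factorial : ℝ) =
      b.factorial / ((n : ℝ) + 1) ^ (b + 1) := by
    rw [← rpow_natCast _ (b + 1)]
    push_cast
    ring
  rw [hval] at hΓ
  have hpos : (0 : ℝ) < b.factorial / ((n : ℝ) + 1) ^ (b + 1) := by positivity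
  have hint := not_imp_comm.1 MeasureTheory.integral_undef (hΓ ▸ hpos.ne')
  rw [← hΓ, MeasureTheory.ofReal_integral_eq_lintegral_ofReal hint]
  · refine MeasureTheory.setLIntegral_congr_fun measurableSet_Ioi fun u hu => ?_
    simp only [abs_neg, abs_exp, log_exp, neg_neg]
    rw [← ENNReal.ofReal_mul (exp_pos _).le, add_sub_cancel_right, rpow_natCast, ← exp_nat_mul,
      ← mul_assoc, ← exp_add, mul_comm]
    congr 3
    ring
  · refine (MeasureTheory.ae_restrict_iff' measurableSet_Ioi).2 (.of_forall fun u hu => ?_)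
    exact mul_nonneg (rpow_nonneg (le_of_lt hu) _) (exp_pos _).le

theorem one_sub_div_one_add_mem_Ioo {t : ℝ} (ht : t ∈ Set.Ioo (0 : ℝ) 1) :
    (1 - t) / (1 + t) ∈ Set.Ioo (0 : ℝ) 1 := by
  have h0 := ht.1
  have h1 := ht.2
  exact ⟨div_pos (by linarith) (by linarith), (div_lt_one (by linarith)).2 (by linarith)⟩

theorem one_sub_div_one_add_involutive {t : ℝ} (ht : t ∈ Set.Ioo (0 : ℝ) 1) :
    (1 - (1 - t) / (1 + t)) / (1 + (1 - t) / (1 + t)) = t := by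
  have h0 := ht.1
  have : 1 + t ≠ 0 := by linarith
  field_simp
  ring

theorem artanh_one_sub_div_one_add {t : ℝ} (ht : t ∈ Set.Ioo (0 : ℝ) 1) :
    artanh ((1 - t) / (1 + t)) = -log t / 2 := by
  have hφ := one_sub_div_one_add_mem_Ioo ht
  have hinv := one_sub_div_one_add_involutive ht
  rw [artanh_eq_half_log ⟨by linarith [hφ.1], hφ.2.le⟩,
    ← inv_div (1 - (1 - t) / (1 + t)), hinv, log_inv]
  ring

theorem neg_log_one_sub_div_one_add {t : ℝ} (ht : t ∈ Set.Ioo (0 : ℝ) 1) :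
    -log ((1 - t) / (1 + t)) = 2 * artanh t := by
  rw [artanh_eq_half_log ⟨by linarith [ht.1], ht.2.le⟩, ← inv_div (1 + t), log_inv]
  ring

theorem lintegral_Ioo_comp_one_sub_div_one_add (F : ℝ → ℝ) :
    ∫⁻ x in Set.Ioo (0 : ℝ) 1, ENNReal.ofReal (F x) =
      ∫⁻ t in Set.Ioo (0 : ℝ) 1,
        ENNReal.ofReal (2 / (1 + t) ^ 2 * F ((1 - t) / (1 + t))) := by
  have himage : (fun t : ℝ => (1 - t) / (1 + t)) '' Set.Ioo 0 1 = Set.Ioo 0 1 := by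
    ext x
    constructor
    · rintro ⟨t, ht, rfl⟩
      exact one_sub_div_one_add_mem_Ioo ht
    · exact fun hx => ⟨_, one_sub_div_one_add_mem_Ioo hx, one_sub_div_one_add_involutive hx⟩
  conv_lhs => rw [← himage]
  rw [MeasureTheory.lintegral_image_eq_lintegral_abs_deriv_mul measurableSet_Ioo
    (f' := fun t : ℝ => -(2 / (1 + t) ^ 2))]
  · refine MeasureTheory.setLIntegral_congr_fun measurableSet_Ioo fun t ht => ?_
    simp only [abs_neg]
    rw [abs_of_nonneg (by positivity), ENNReal.ofReal_mul (by positivity)]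
  · intro t ht
    have : 1 + t ≠ 0 := by linarith [ht.1]
    have hd := (((hasDerivAt_id t).const_sub 1).div ((hasDerivAt_id t).const_add 1) this)
    refine (hd.congr_deriv ?_).hasDerivWithinAt
    simp only [id]
    ring
  · intro s hs t ht hst
    rw [← one_sub_div_one_add_involutive hs, ← one_sub_div_one_add_involutive ht]
    simp only at hst
    rw [hst]

/-- Two series expansions of an integrand, before and after the substitution
`x = (1 - t) / (1 + t)`, integrate termwise to the same sum. -/
theorem hasSum_of_dual_expansions {f g : ℕ → ℝ → ℝ} {F : ℝ → ℝ} {a b : ℕ → ℝ} {B : ℝ}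
    (hfm : ∀ n, Measurable (f n)) (hf0 : ∀ n, ∀ x ∈ Set.Ioo (0 : ℝ) 1, 0 ≤ f n x)
    (hfF : ∀ x ∈ Set.Ioo (0 : ℝ) 1, HasSum (fun n => f n x) (F x))
    (ha : ∀ n, ∫⁻ x in Set.Ioo (0 : ℝ) 1, ENNReal.ofReal (f n x) = ENNReal.ofReal (a n))
    (hgm : ∀ n, Measurable (g n)) (hg0 : ∀ n, ∀ t ∈ Set.Ioo (0 : ℝ) 1, 0 ≤ g n t)
    (hgF : ∀ t ∈ Set.Ioo (0 : ℝ) 1,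
      HasSum (fun n => g n t) (2 / (1 + t) ^ 2 * F ((1 - t) / (1 + t))))
    (hb : ∀ n, ∫⁻ t in Set.Ioo (0 : ℝ) 1, ENNReal.ofReal (g n t) = ENNReal.ofReal (b n))
    (ha0 : ∀ n, 0 ≤ a n) (hb0 : ∀ n, 0 ≤ b n) (hB : HasSum b B) : HasSum a B := by
  refine hasSum_of_tsum_ofReal_eq ha0 (hB.nonneg hb0) ?_
  rw [← lintegral_Ioo_eq_tsum hfm hf0 hfF ha, lintegral_Ioo_comp_one_sub_div_one_add F,
    lintegral_Ioo_eq_tsum hgm hg0 hgF hb, tsum_ofReal_eq_of_hasSum hb0 hB]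

theorem measurable_artanh : Measurable artanh := by
  unfold artanh
  fun_prop

theorem neg_log_nonneg {x : ℝ} (hx : x ∈ Set.Ioo (0 : ℝ) 1) : 0 ≤ -log x :=
  neg_nonneg.2 (log_nonpos hx.1.le hx.2.le)

theorem hasSum_artanh_sq {x : ℝ} (hx : x ∈ Set.Ioo (0 : ℝ) 1) :
    HasSum (fun n : ℕ => h (n + 1) / ((n : ℝ) + 1) * x ^ (2 * n)) (artanh x ^ 2 / x ^ 2) := by
  have := hasSum_artanhSeries_pow hx 2
  simpa only [coeff_artanhSeries_sq, div_pow, ← pow_mul] using this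

theorem hasSum_sq_pow {t : ℝ} (ht : t ∈ Set.Ioo (0 : ℝ) 1) :
    HasSum (fun n : ℕ => t ^ (2 * n)) (1 / (1 - t ^ 2)) := by
  simp_rw [pow_mul, one_div]
  exact hasSum_geometric_of_lt_one (sq_nonneg t) (by nlinarith [ht.1, ht.2])

theorem hasSum_inv_sub_inv_add_nat {d : ℝ} (hd : 0 < d) (k : ℕ) :
    HasSum (fun n : ℕ => 1 / ((n : ℝ) + d) - 1 / ((n : ℝ) + d + k))
      (∑ j ∈ Finset.range k, 1 / ((j : ℝ) + d)) := by
  induction k with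
  | zero => simp
  | succ k ih =>
    have hstep : HasSum (fun n : ℕ => 1 / ((n : ℝ) + d + k) - 1 / ((n : ℝ) + 1 + d + k))
        (1 / ((k : ℝ) + d)) := by
      have hlim : Filter.Tendsto (fun n : ℕ => 1 / ((n : ℝ) + d + k)) Filter.atTop (nhds 0) := by
        simp_rw [one_div]
        exact tendsto_inv_atTop_zero.comp (Filter.tendsto_atTop_add_const_right _ _
          (Filter.tendsto_atTop_add_const_right _ _ tendsto_natCast_atTop_atTop))
      have := hasSum_of_nonneg_telescoping
        (f := fun n : ℕ => 1 / ((n : ℝ) + d + k) - 1 / ((n : ℝ) + 1 + d + k))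
        (v := fun n : ℕ => 1 / ((n : ℝ) + d + k))
        (fun n => sub_nonneg.2 (one_div_le_one_div_of_le (by positivity) (by linarith)))
        (fun n => by push_cast; ring) hlim
      simpa [add_comm] using this
    rw [Finset.sum_range_succ]
    convert! ih.add hstep using 2 with n
    push_cast
    ring

theorem hasSum_inv_odd_mul_inv_odd (k : ℕ) :
    HasSum (fun n : ℕ => 1 / (2 * (n : ℝ) + 1) * (1 / (2 * (n : ℝ) + 2 * k + 3)))
      (h (k + 1) / (2 * ((k : ℝ) + 1))) := by
  convert! (hasSum_inv_sub_inv_add_nat (d := 1 / 2) (by norm_num) (k + 1)).mul_left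
    (1 / (4 * ((k : ℝ) + 1))) using 1
  · ext n
    push_cast
    field_simp
    ring
  · rw [h, Finset.sum_div, Finset.mul_sum]
    refine Finset.sum_congr rfl fun j _ => ?_
    field_simp
    ring

theorem hasSum_inv_mul_inv_add (k : ℕ) :
    HasSum (fun n : ℕ => 1 / (((n : ℝ) + 1) * ((n : ℝ) + 1 + (k + 1))))
      (H (k + 1) / ((k : ℝ) + 1)) := by
  convert! (hasSum_inv_sub_inv_add_nat zero_lt_one (k + 1)).mul_left (1 / ((k : ℝ) + 1)) using 1
  · ext n
    push_cast
    field_simp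
    ring
  · rw [H]
    ring

theorem hasSum_artanh {x : ℝ} (hx : x ∈ Set.Ioo (0 : ℝ) 1) :
    HasSum (fun n : ℕ => 1 / (2 * (n : ℝ) + 1) * x ^ (2 * n)) (artanh x / x) := by
  have := hasSum_artanhSeries_pow hx 1
  simpa only [pow_one, artanhSeries, PowerSeries.coeff_mk, ← pow_mul] using this

theorem lintegral_Ioo_pow (n : ℕ) :
    ∫⁻ x in Set.Ioo (0 : ℝ) 1, ENNReal.ofReal (x ^ n) = ENNReal.ofReal (1 / ((n : ℝ) + 1)) := by
  simpa using lintegral_Ioo_pow_mul_neg_log_pow n 0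

theorem lintegral_Ioo_pow_mul_artanh (k : ℕ) :
    ∫⁻ x in Set.Ioo (0 : ℝ) 1, ENNReal.ofReal (x ^ (2 * k + 1) * artanh x) =
      ENNReal.ofReal (h (k + 1) / (2 * ((k : ℝ) + 1))) := by
  rw [← tsum_ofReal_eq_of_hasSum (fun n => by positivity) (hasSum_inv_odd_mul_inv_odd k)]
  refine lintegral_Ioo_eq_tsum
    (f := fun n x => 1 / (2 * (n : ℝ) + 1) * x ^ (2 * n + 2 * k + 2))
    (fun n => by fun_prop) (fun n x hx => mul_nonneg (by positivity) (pow_nonneg hx.1.le _))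
    (fun x hx => ?_) (fun n => ?_)
  · have hx0 := hx.1.ne'
    convert! (hasSum_artanh hx).mul_left (x ^ (2 * k + 2)) using 1
    · ext n
      ring
    · field_simp
      ring
  · have := lintegral_Ioo_const_mul (c := 1 / (2 * (n : ℝ) + 1)) (by positivity) (by fun_prop)
      (lintegral_Ioo_pow (2 * n + 2 * k + 2))
    rw [this]
    push_cast
    ring_nf

theorem hasSum_zeta {s : ℕ} (hs : 1 < s) :
    HasSum (fun n : ℕ => 1 / ((n : ℝ) + 1) ^ s) (zeta s) := by
  have := (summable_nat_add_iff 1).2 (summable_one_div_nat_pow.2 hs)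
  push_cast at this
  exact this.hasSum

theorem hasSum_odd_zeta {s : ℕ} (hs : 1 < s) :
    HasSum (fun n : ℕ => 1 / (2 * (n : ℝ) + 1) ^ s) ((1 - 1 / 2 ^ s) * zeta s) := by
  have hz := hasSum_zeta hs
  have hodd : Summable fun n : ℕ => 1 / (2 * (n : ℝ) + 1) ^ s := by
    have := hz.summable.comp_injective (i := fun n : ℕ => 2 * n) fun a b hab => by simpa using hab
    simpa [Function.comp_def] using this
  have heven : HasSum (fun n : ℕ => 1 / (((2 * n + 1 : ℕ) : ℝ) + 1) ^ s)
      (1 / 2 ^ s * zeta s) := by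
    convert! hz.mul_left (1 / 2 ^ s) using 2 with n
    push_cast
    rw [show 2 * (n : ℝ) + 1 + 1 = 2 * (n + 1) by ring, mul_pow, one_div_mul_one_div]
  have hsplit := HasSum.even_add_odd (f := fun n : ℕ => 1 / ((n : ℝ) + 1) ^ s)
    (m := ∑' n : ℕ, 1 / (2 * (n : ℝ) + 1) ^ s) (by simpa using hodd.hasSum) heven
  have := hsplit.unique hz
  rw [show (1 - 1 / 2 ^ s) * zeta s = ∑' n : ℕ, 1 / (2 * (n : ℝ) + 1) ^ s by linarith]
  exact hodd.hasSum

theorem lintegral_Ioo_pow_sub_pow (n : ℕ) :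
    ∫⁻ x in Set.Ioo (0 : ℝ) 1, ENNReal.ofReal (x ^ n - x ^ (n + 2)) =
      ENNReal.ofReal (1 / ((n : ℝ) + 1) - 1 / ((n : ℝ) + 3)) := by
  have hint : MeasureTheory.IntegrableOn (fun x : ℝ => x ^ n - x ^ (n + 2)) (Set.Ioo 0 1) :=
    (Continuous.integrableOn_Icc (by fun_prop)).mono_set Set.Ioo_subset_Icc_self
  rw [← MeasureTheory.ofReal_integral_eq_lintegral_ofReal hint,
    ← MeasureTheory.integral_Ioc_eq_integral_Ioo, ← intervalIntegral.integral_of_le zero_le_one,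
    intervalIntegral.integral_sub (by simp) (by simp), integral_pow, integral_pow]
  · push_cast
    norm_num [add_assoc]
  · refine (MeasureTheory.ae_restrict_iff' measurableSet_Ioo).2 (.of_forall fun x hx => ?_)
    exact sub_nonneg.2 (pow_le_pow_of_le_one hx.1.le hx.2.le (Nat.le_add_right _ _))

theorem hasSum_succ_mul_pow {t : ℝ} (ht : t ∈ Set.Ioo (0 : ℝ) 1) :
    HasSum (fun n : ℕ => ((n : ℝ) + 1) * t ^ (2 * n)) (1 / (1 - t ^ 2) ^ 2) := by
  have := hasSum_choose_mul_geometric_of_norm_lt_one 1 (r := t ^ 2)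
    (by rw [norm_of_nonneg (sq_nonneg t)]; nlinarith [ht.1, ht.2])
  simpa [pow_mul] using this

theorem hasSum_h_div_mul_inv_odd_sub :
    HasSum (fun n : ℕ => h (n + 1) / ((n : ℝ) + 1) *
      (1 / (2 * (n : ℝ) + 1) - 1 / (2 * (n : ℝ) + 3))) (1 / 2 * zeta 2) := by
  have hc (n : ℕ) : 0 ≤ h (n + 1) / ((n : ℝ) + 1) := div_nonneg (h_nonneg _) (by positivity)
  refine hasSum_of_dual_expansions
    (f := fun n x => h (n + 1) / ((n : ℝ) + 1) * (x ^ (2 * n) - x ^ (2 * n + 2)))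
    (g := fun n t => 2 * ((n : ℝ) + 1) * (t ^ (2 * n + 1) * (-log t) ^ 2))
    (F := fun x => artanh x ^ 2 / x ^ 2 * (1 - x ^ 2))
    (b := fun n => 1 / 2 * (1 / ((n : ℝ) + 1) ^ 2))
    (fun n => by fun_prop) (fun n x hx => mul_nonneg (hc n) (sub_nonneg.2
      (pow_le_pow_of_le_one hx.1.le hx.2.le (Nat.le_add_right _ _))))
    (fun x hx => ?_) (fun n => ?_) (fun n => by fun_prop)
    (fun n t ht => mul_nonneg (by positivity) (mul_nonneg (pow_nonneg ht.1.le _) (sq_nonneg _)))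
    (fun t ht => ?_) (fun n => ?_) (fun n => mul_nonneg (hc n) (sub_nonneg.2
      (one_div_le_one_div_of_le (by positivity) (by linarith)))) (fun n => by positivity)
    ((hasSum_zeta one_lt_two).mul_left _)
  · convert! (hasSum_artanh_sq hx).mul_right (1 - x ^ 2) using 2 with n
    ring
  · rw [lintegral_Ioo_const_mul (hc n) (by fun_prop) (lintegral_Ioo_pow_sub_pow (2 * n))]
    push_cast
    rfl
  · convert! (hasSum_succ_mul_pow ht).mul_left (2 * t * (-log t) ^ 2) using 1
    · ext n
      ring
    · rw [artanh_one_sub_div_one_add ht]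
      have h1 : 1 + t ≠ 0 := by linarith [ht.1]
      have h2 : 1 - t ≠ 0 := by linarith [ht.2]
      rw [show 1 - t ^ 2 = (1 - t) * (1 + t) by ring]
      field_simp
      ring
  · rw [lintegral_Ioo_const_mul (by positivity) (by fun_prop)
      (lintegral_Ioo_pow_mul_neg_log_pow (2 * n + 1) 2)]
    congr 1
    push_cast [Nat.factorial]
    field_simp
    ring

theorem hasSum_h_div_sq :
    HasSum (fun n : ℕ => h (n + 1) / ((n : ℝ) + 1) ^ 2) (7 / 4 * zeta 3) := by
  have hc (n : ℕ) : 0 ≤ h (n + 1) / ((n : ℝ) + 1) := div_nonneg (h_nonneg _) (by positivity)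
  have key := hasSum_of_dual_expansions
    (f := fun n x => h (n + 1) / ((n : ℝ) + 1) * x ^ (2 * n + 1))
    (g := fun n t => 1 / 2 * (t ^ (2 * n) * (-log t) ^ 2))
    (F := fun x => artanh x ^ 2 / x)
    (a := fun n => h (n + 1) / ((n : ℝ) + 1) * (1 / (2 * (n : ℝ) + 2)))
    (b := fun n => 1 / (2 * (n : ℝ) + 1) ^ 3)
    (fun n => by fun_prop) (fun n x hx => mul_nonneg (hc n) (pow_nonneg hx.1.le _))
    (fun x hx => ?_) (fun n => ?_) (fun n => by fun_prop)
    (fun n t ht => mul_nonneg (by positivity) (mul_nonneg (pow_nonneg ht.1.le _) (sq_nonneg _)))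
    (fun t ht => ?_) (fun n => ?_) (fun n => mul_nonneg (hc n) (by positivity))
    (fun n => by positivity) (hasSum_odd_zeta (by norm_num))
  · convert! key.mul_left 2 using 1
    · ext n
      field_simp
    · ring
  · have hx0 := hx.1.ne'
    convert! (hasSum_artanh_sq hx).mul_right x using 1
    · ext n
      ring
    · field_simp
  · rw [lintegral_Ioo_const_mul (hc n) (by fun_prop) (lintegral_Ioo_pow (2 * n + 1))]
    congr 2
    push_cast
    ring
  · convert! (hasSum_sq_pow ht).mul_left (1 / 2 * (-log t) ^ 2) using 1
    · ext n
      ring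
    · rw [artanh_one_sub_div_one_add ht]
      have h1 : 1 + t ≠ 0 := by linarith [ht.1]
      have h2 : 1 - t ≠ 0 := by linarith [ht.2]
      rw [show 1 - t ^ 2 = (1 - t) * (1 + t) by ring]
      field_simp
  · rw [lintegral_Ioo_const_mul (by positivity) (by fun_prop)
      (lintegral_Ioo_pow_mul_neg_log_pow (2 * n) 2)]
    congr 1
    push_cast [Nat.factorial]
    field_simp

theorem artanh_nonneg_of_mem_Ioo {x : ℝ} (hx : x ∈ Set.Ioo (0 : ℝ) 1) : 0 ≤ artanh x := by
  have := neg_log_one_sub_div_one_add hx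
  linarith [neg_log_nonneg (one_sub_div_one_add_mem_Ioo hx)]

theorem hasSum_h_sq_div_sq :
    HasSum (fun n : ℕ => h (n + 1) ^ 2 / ((n : ℝ) + 1) ^ 2) (45 / 16 * zeta 4) := by
  have hc (n : ℕ) : 0 ≤ h (n + 1) / ((n : ℝ) + 1) := div_nonneg (h_nonneg _) (by positivity)
  have hm := measurable_artanh
  have key := hasSum_of_dual_expansions
    (f := fun n x => h (n + 1) / ((n : ℝ) + 1) * (x ^ (2 * n + 1) * artanh x))
    (g := fun n t => 1 / 4 * (t ^ (2 * n) * (-log t) ^ 3))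
    (F := fun x => artanh x ^ 3 / x)
    (a := fun n => h (n + 1) / ((n : ℝ) + 1) * (h (n + 1) / (2 * ((n : ℝ) + 1))))
    (b := fun n => 3 / 2 * (1 / (2 * (n : ℝ) + 1) ^ 4))
    (fun n => by fun_prop)
    (fun n x hx => mul_nonneg (hc n)
      (mul_nonneg (pow_nonneg hx.1.le _) (artanh_nonneg_of_mem_Ioo hx)))
    (fun x hx => ?_) (fun n => ?_) (fun n => by fun_prop)
    (fun n t ht => mul_nonneg (by positivity)
      (mul_nonneg (pow_nonneg ht.1.le _) (pow_nonneg (neg_log_nonneg ht) _)))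
    (fun t ht => ?_) (fun n => ?_)
    (fun n => mul_nonneg (hc n) (div_nonneg (h_nonneg _) (by positivity)))
    (fun n => by positivity) ((hasSum_odd_zeta (by norm_num)).mul_left _)
  · convert! key.mul_left 2 using 1
    · ext n
      field_simp
    · ring
  · have hx0 := hx.1.ne'
    convert! (hasSum_artanh_sq hx).mul_right (x * artanh x) using 1
    · ext n
      ring
    · field_simp
  · exact lintegral_Ioo_const_mul (hc n) (by fun_prop) (lintegral_Ioo_pow_mul_artanh n)
  · convert! (hasSum_sq_pow ht).mul_left (1 / 4 * (-log t) ^ 3) using 1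
    · ext n
      ring
    · rw [artanh_one_sub_div_one_add ht]
      have h1 : 1 + t ≠ 0 := by linarith [ht.1]
      have h2 : 1 - t ≠ 0 := by linarith [ht.2]
      rw [show 1 - t ^ 2 = (1 - t) * (1 + t) by ring]
      field_simp
      ring
  · rw [lintegral_Ioo_const_mul (by positivity) (by fun_prop)
      (lintegral_Ioo_pow_mul_neg_log_pow (2 * n) 3)]
    congr 1
    push_cast [Nat.factorial]
    field_simp
    ring

theorem hasSum_h_mul_odd_pow {t : ℝ} (ht : t ∈ Set.Ioo (0 : ℝ) 1) :
    HasSum (fun n : ℕ => h (n + 1) * t ^ (2 * n)) (artanh t / t * (1 / (1 - t ^ 2))) := by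
  convert! hasSum_antidiagonal_mul (hasSum_artanh ht) (hasSum_sq_pow ht) using 2 with n
  rw [Finset.Nat.sum_antidiagonal_eq_sum_range_succ
    (fun i j => 1 / (2 * (i : ℝ) + 1) * t ^ (2 * i) * t ^ (2 * j)), h, Finset.sum_mul]
  refine Finset.sum_congr rfl fun i hi => ?_
  rw [mul_assoc, ← pow_add]
  congr 2
  have := Finset.mem_range.1 hi
  lia

theorem hDivSum_nonneg (n : ℕ) : 0 ≤ hDivSum n :=
  Finset.sum_nonneg fun _ _ => div_nonneg (h_nonneg _) (by positivity)

theorem hDivOddSum_nonneg (n : ℕ) : 0 ≤ hDivOddSum n :=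
  Finset.sum_nonneg fun _ _ => div_nonneg (hDivSum_nonneg _) (by positivity)

theorem hasSum_hDivOddSum_div_cube {S : ℝ}
    (hS : HasSum (fun n : ℕ => h (n + 1) / ((n : ℝ) + 1) ^ 5) S) :
    HasSum (fun n : ℕ => hDivOddSum (n + 1) / ((n : ℝ) + 1) ^ 3) (1 / 8 * S) := by
  have hc (n : ℕ) : 0 ≤ 6 * hDivOddSum (n + 2) / ((n : ℝ) + 2) :=
    div_nonneg (mul_nonneg (by norm_num) (hDivOddSum_nonneg _)) (by positivity)
  have hm := measurable_artanh
  have key := hasSum_of_dual_expansions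
    (f := fun n x => 6 * hDivOddSum (n + 2) / ((n : ℝ) + 2) * (x ^ (2 * n + 3) * (-log x) ^ 1))
    (g := fun n t => 1 / 4 * h (n + 1) * (t ^ (2 * n + 1) * (-log t) ^ 4))
    (F := fun x => artanh x ^ 4 / x * (-log x))
    (a := fun n => 6 * hDivOddSum (n + 2) / ((n : ℝ) + 2) * (1 / (2 * (n : ℝ) + 4) ^ 2))
    (b := fun n => 3 / 16 * (h (n + 1) / ((n : ℝ) + 1) ^ 5))
    (fun n => by fun_prop)
    (fun n x hx => mul_nonneg (hc n)
      (mul_nonneg (pow_nonneg hx.1.le _) (pow_nonneg (neg_log_nonneg hx) _)))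
    (fun x hx => ?_) (fun n => ?_) (fun n => by fun_prop)
    (fun n t ht => mul_nonneg (mul_nonneg (by norm_num) (h_nonneg _))
      (mul_nonneg (pow_nonneg ht.1.le _) (pow_nonneg (neg_log_nonneg ht) _)))
    (fun t ht => ?_) (fun n => ?_)
    (fun n => mul_nonneg (hc n) (by positivity))
    (fun n => mul_nonneg (by norm_num) (div_nonneg (h_nonneg _) (by positivity)))
    (hS.mul_left _)
  · rw [← hasSum_nat_add_iff' 1]
    convert! key.mul_left (2 / 3) using 1
    · ext n
      push_cast
      rw [show (n : ℝ) + 1 + 1 = n + 2 by ring]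
      field_simp
      ring
    · simp [hDivOddSum, hDivSum]
      ring
  · have hx0 := hx.1.ne'
    have := hasSum_artanhSeries_pow hx 4
    simp only [coeff_artanhSeries_pow_four] at this
    convert! this.mul_right (x ^ 3 * (-log x)) using 1
    · ext n
      ring
    · field_simp
  · rw [lintegral_Ioo_const_mul (hc n) (by fun_prop)
      (lintegral_Ioo_pow_mul_neg_log_pow (2 * n + 3) 1)]
    congr 2
    push_cast [Nat.factorial]
    ring
  · convert! (hasSum_h_mul_odd_pow ht).mul_left (1 / 4 * (-log t) ^ 4 * t) using 1
    · ext n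
      ring
    · rw [artanh_one_sub_div_one_add ht, neg_log_one_sub_div_one_add ht]
      have h0 := ht.1.ne'
      have h1 : 1 + t ≠ 0 := by linarith [ht.1]
      have h2 : 1 - t ≠ 0 := by linarith [ht.2]
      rw [show 1 - t ^ 2 = (1 - t) * (1 + t) by ring]
      field_simp
      ring
  · rw [lintegral_Ioo_const_mul (mul_nonneg (by norm_num) (h_nonneg _)) (by fun_prop)
      (lintegral_Ioo_pow_mul_neg_log_pow (2 * n + 1) 4)]
    congr 1
    push_cast [Nat.factorial]
    field_simp
    ring

theorem zeta_eq_of_hasSum {s : ℕ} (hs : s ≠ 0) {a : ℝ}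
    (ha : HasSum (fun n : ℕ => 1 / (n : ℝ) ^ s) a) : zeta s = a := by
  rw [← hasSum_nat_add_iff' 1] at ha
  simpa [hs, zeta] using ha.tsum_eq

theorem zeta_two_mul_zeta_four : zeta 2 * zeta 4 = 7 / 4 * zeta 6 := by
  have h6 : bernoulli 6 = 1 / 42 := by
    rw [bernoulli_eq_bernoulli'_of_ne_one (by norm_num), bernoulli'_def]
    norm_num [Finset.sum_range_succ, Nat.choose, bernoulli'_eq_zero_of_odd]
  rw [zeta_eq_of_hasSum two_ne_zero hasSum_zeta_two,
    zeta_eq_of_hasSum four_ne_zero hasSum_zeta_four,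
    zeta_eq_of_hasSum (by norm_num) (hasSum_zeta_nat (k := 3) three_ne_zero)]
  norm_num [h6, Nat.factorial]
  ring

theorem summable_h_div_pow (s : ℕ) :
    Summable fun n : ℕ => h (n + 1) / ((n : ℝ) + 1) ^ (s + 2) := by
  refine Summable.of_nonneg_of_le (fun n => div_nonneg (h_nonneg _) (by positivity)) (fun n => ?_)
    hasSum_h_div_sq.summable
  exact div_le_div_of_nonneg_left (h_nonneg _) (by positivity)
    (pow_le_pow_right₀ (by simp) (Nat.le_add_left 2 s))

theorem hasSum_h_mul_shiftSum_h_div_cube :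
    HasSum (fun n : ℕ => h (n + 1) * shiftSum h (n + 1) / ((n : ℝ) + 1) ^ 3)
      (49 / 32 * zeta 3 ^ 2) := by
  set c : ℕ → ℝ := fun n => h (n + 1) / ((n : ℝ) + 1) ^ 2 with hc_def
  have hc : HasSum c (7 / 4 * zeta 3) := hasSum_h_div_sq
  have hc0 (n : ℕ) : 0 ≤ c n := div_nonneg (h_nonneg _) (by positivity)
  let f : ℕ × ℕ → ℝ := fun p =>
    c p.1 * (h (p.2 + 1) / (((p.2 : ℝ) + 1) * ((p.2 : ℝ) + 1 + (p.1 + 1))))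
  have hf0 (p : ℕ × ℕ) : 0 ≤ f p :=
    mul_nonneg (hc0 _) (div_nonneg (h_nonneg _) (by positivity))
  have hadd (p : ℕ × ℕ) : f p + f p.swap = c p.1 * c p.2 := by
    simp only [f, c, Prod.fst_swap, Prod.snd_swap]
    field_simp
    ring
  have hcc : HasSum (fun p : ℕ × ℕ => c p.1 * c p.2) (7 / 4 * zeta 3 * (7 / 4 * zeta 3)) :=
    hc.mul hc (hc.summable.mul_of_nonneg hc.summable hc0 hc0)
  have hf : Summable f := Summable.of_nonneg_of_le hf0
    (fun p => by linarith [hadd p, hf0 p.swap]) hcc.summable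
  have hswap : HasSum (fun p : ℕ × ℕ => f p.swap) (∑' p, f p) :=
    (Equiv.prodComm ℕ ℕ).hasSum_iff.2 hf.hasSum
  have htot : ∑' p, f p = 49 / 32 * zeta 3 ^ 2 := by
    have := hf.hasSum.add hswap
    simp only [hadd] at this
    linarith [this.unique hcc]
  rw [← htot]
  refine hf.hasSum.prod_fiberwise fun k => ?_
  convert! (hasSum_shiftSum h_nonneg hc.summable (k + 1)).mul_left
    (h (k + 1) / ((k : ℝ) + 1) ^ 3) using 1
  · ext j
    simp only [f, c]
    push_cast
    field_simp
    ring
  · ring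

theorem hasSum_shiftSum_h_sq_div_cube :
    HasSum (fun n : ℕ => shiftSum (fun n => h n ^ 2) (n + 1) / ((n : ℝ) + 1) ^ 3)
      (1 / 2 * zeta 2 * (∑' k : ℕ, h (k + 1) / ((k : ℝ) + 1) ^ 3) + 49 / 32 * zeta 3 ^ 2 -
        1 / 8 * ∑' k : ℕ, h (k + 1) / ((k : ℝ) + 1) ^ 5) := by
  convert! (((summable_h_div_pow 1).hasSum.mul_left (1 / 2 * zeta 2)).add
    hasSum_h_mul_shiftSum_h_div_cube).sub
      (hasSum_hDivOddSum_div_cube (summable_h_div_pow 3).hasSum) using 2 with n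
  rw [shiftSum_h_sq_eq hasSum_h_sq_div_sq.summable hasSum_h_div_mul_inv_odd_sub]
  ring

theorem hasSum_H_mul_h_sq_div_cube :
    HasSum (fun k : ℕ => H (k + 1) * (h (k + 1)) ^ 2 / ((k : ℝ) + 1) ^ 3)
      (45 / 16 * zeta 4 * zeta 2 -
        (1 / 2 * zeta 2 * (∑' k : ℕ, h (k + 1) / ((k : ℝ) + 1) ^ 3) + 49 / 32 * zeta 3 ^ 2 -
          1 / 8 * ∑' k : ℕ, h (k + 1) / ((k : ℝ) + 1) ^ 5)) := by
  refine hasSum_swap_of_nonneg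
    (f := fun m k : ℕ => h (k + 1) ^ 2 / ((k : ℝ) + 1) ^ 2 *
      (1 / (((m : ℝ) + 1) * ((m : ℝ) + 1 + (k + 1)))))
    (fun m k => by positivity) (fun m => ?_) (fun k => ?_)
    (((hasSum_zeta one_lt_two).mul_left (45 / 16 * zeta 4)).sub hasSum_shiftSum_h_sq_div_cube)
  · have hW := (hasSum_shiftSum (a := fun n => h n ^ 2) (fun n => sq_nonneg _)
      hasSum_h_sq_div_sq.summable (m + 1)).div_const (((m : ℝ) + 1) ^ 3)
    convert! (hasSum_h_sq_div_sq.mul_right (1 / ((m : ℝ) + 1) ^ 2)).sub hW using 2 with k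
    push_cast
    field_simp
    ring
  · convert! (hasSum_inv_mul_inv_add k).mul_left (h (k + 1) ^ 2 / ((k : ℝ) + 1) ^ 2) using 1
    field_simp

theorem stmt15 :
    Summable (fun k : ℕ => h (k + 1) / ((k : ℝ) + 1) ^ 3) ∧
    Summable (fun k : ℕ => h (k + 1) / ((k : ℝ) + 1) ^ 5) ∧
    HasSum (fun k : ℕ => H (k + 1) * (h (k + 1)) ^ 2 / ((k : ℝ) + 1) ^ 3)
      ((315 / 64) * zeta 6 - (49 / 32) * (zeta 3) ^ 2
        - (1 / 2) * zeta 2 * (∑' k : ℕ, h (k + 1) / ((k : ℝ) + 1) ^ 3)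
        + (1 / 8) * (∑' k : ℕ, h (k + 1) / ((k : ℝ) + 1) ^ 5)) := by
  refine ⟨summable_h_div_pow 1, summable_h_div_pow 3, ?_⟩
  convert! hasSum_H_mul_h_sq_div_cube using 1
  linarith [zeta_two_mul_zeta_four]
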